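/- Let d ≥ 2, let V be a real symmetric d×d matrix with λ_min(V) > 1, let β ≥ 0, let θ ∈ S^{d-1}, and let θ̂ ∈ ℝ^d be nonzero with ⟨θ − θ̂, V(θ − θ̂)⟩ ≤ β. Let v ∈ S^{d-1} be any unit vector and define ã± := θ̂/‖θ̂‖₂ ± (1/√(λ_min(V))) v and a± := ã±/‖ã±‖₂. Then ‖θ − a⁺‖₂ ≤ 2 √(β/λ_min(V)) + √(2/λ_min(V)) and ‖θ − a⁻‖₂ ≤ 2 √(β/λ_min(V)) + √(2/λ_min(V)). -/

import Mathlib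

open Matrix
open scoped Classical

/-- The smallest eigenvalue of a real symmetric matrix (junk value `0` otherwise). -/
noncomputable def matLamMin {n : ℕ} (A : Matrix (Fin n) (Fin n) ℝ) : ℝ :=
  if h : A.IsHermitian then ⨅ i, h.eigenvalues i else 0

/-- The Euclidean norm of a vector `u ∈ ℝ^d`. -/
noncomputable def evnorm {d : ℕ} (u : Fin d → ℝ) : ℝ :=
  Real.sqrt (∑ i, u i ^ 2)

/-- The normalization `u / ‖u‖₂` of a vector `u ∈ ℝ^d`. -/
noncomputable def unitize {d : ℕ} (u : Fin d → ℝ) : Fin d → ℝ :=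
  (evnorm u)⁻¹ • u

theorem evnorm_eq_norm {d : ℕ} (u : Fin d → ℝ) : evnorm u = ‖WithLp.toLp 2 u‖ := by
  simp [evnorm, EuclideanSpace.norm_eq]

theorem toLp_unitize {d : ℕ} (u : Fin d → ℝ) :
    WithLp.toLp 2 (unitize u) = ‖WithLp.toLp 2 u‖⁻¹ • WithLp.toLp 2 u := by
  rw [unitize, WithLp.toLp_smul, evnorm_eq_norm]

/-- The Rayleigh bound `λ_min(V) ‖x‖² ≤ ⟨x, V x⟩`. -/
theorem matLamMin_mul_evnorm_sq_le {d : ℕ} {V : Matrix (Fin d) (Fin d) ℝ} (hV : V.IsHermitian)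
    (x : Fin d → ℝ) : matLamMin V * evnorm x ^ 2 ≤ x ⬝ᵥ V.mulVec x := by
  have hself : ∀ i, inner ℝ (hV.eigenvectorBasis i) (WithLp.toLp 2 (V.mulVec x)) =
      hV.eigenvalues i * inner ℝ (hV.eigenvectorBasis i) (WithLp.toLp 2 x) := by
    intro i
    have hT : Vᵀ = V := by simpa [Matrix.IsHermitian] using hV
    have h := hV.mulVec_eigenvectorBasis i
    rw [EuclideanSpace.inner_eq_star_dotProduct, EuclideanSpace.inner_eq_star_dotProduct,
      star_trivial, dotProduct_comm, dotProduct_mulVec, ← mulVec_transpose, hT, h,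
      smul_dotProduct, smul_eq_mul, dotProduct_comm]
  have hquad : x ⬝ᵥ V.mulVec x =
      ∑ i, hV.eigenvalues i * inner ℝ (hV.eigenvectorBasis i) (WithLp.toLp 2 x) ^ 2 := by
    have h := hV.eigenvectorBasis.sum_inner_mul_inner (WithLp.toLp 2 x)
      (WithLp.toLp 2 (V.mulVec x))
    rw [EuclideanSpace.inner_eq_star_dotProduct, star_trivial, dotProduct_comm] at h
    rw [← h]
    refine Finset.sum_congr rfl fun i _ => ?_
    rw [hself, real_inner_comm]
    ring
  have hnorm := hV.eigenvectorBasis.sum_sq_norm_inner_right (WithLp.toLp 2 x)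
  rw [hquad, evnorm_eq_norm, ← hnorm, Finset.mul_sum, matLamMin, dif_pos hV]
  refine Finset.sum_le_sum fun i _ => ?_
  rw [Real.norm_eq_abs, sq_abs]
  exact mul_le_mul_of_nonneg_right (ciInf_le (Set.finite_range _).bddBelow i) (sq_nonneg _)

section InnerProductSpace

variable {E : Type*} [NormedAddCommGroup E]

theorem norm_sub_normalize_le [NormedSpace ℝ E] {x y : E} (hx : ‖x‖ = 1) (hy : y ≠ 0) :
    ‖x - ‖y‖⁻¹ • y‖ ≤ 2 * ‖x - y‖ := by
  have hy' : ‖y‖ ≠ 0 := norm_ne_zero_iff.2 hy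
  have h : ‖y - ‖y‖⁻¹ • y‖ = |‖y‖ - ‖x‖| := by
    have : y - ‖y‖⁻¹ • y = ((‖y‖ - 1) * ‖y‖⁻¹) • y := by
      rw [sub_mul, mul_inv_cancel₀ hy', sub_smul, one_smul, one_mul]
    rw [this, norm_smul, norm_mul, norm_inv, norm_norm, mul_assoc, inv_mul_cancel₀ hy', hx,
      mul_one, Real.norm_eq_abs]
  have h₁ := norm_sub_le_norm_sub_add_norm_sub x y (‖y‖⁻¹ • y)
  have h₂ := abs_norm_sub_norm_le y x
  rw [norm_sub_rev y x] at h₂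
  linarith

variable [InnerProductSpace ℝ E]

/-- Perturbing a unit vector by a vector of length `c < 1` and renormalizing moves it by at most
`√2 c`. -/
theorem norm_sub_normalize_add_smul_le {u v : E} (hu : ‖u‖ = 1) (hv : ‖v‖ = 1) {c : ℝ}
    (hc0 : 0 ≤ c) (hc1 : c < 1) :
    ‖u - ‖u + c • v‖⁻¹ • (u + c • v)‖ ≤ √2 * c := by
  set w := u + c • v with hw
  set s := inner ℝ u v with hs
  have hs1 : |s| ≤ 1 := by simpa [hu, hv] using abs_real_inner_le_norm u v
  have hs2 := (abs_le.1 hs1).1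
  have huw : inner ℝ u w = 1 + c * s := by
    rw [hw, inner_add_right, inner_smul_right, real_inner_self_eq_norm_sq, hu]
    norm_num [hs]
  have hN2 : ‖w‖ ^ 2 = 1 + 2 * c * s + c ^ 2 := by
    rw [hw, norm_add_sq_real, norm_smul, inner_smul_right, hu, hv, Real.norm_eq_abs, mul_one,
      sq_abs]
    ring
  have hpos : 0 < 1 + c * s := by nlinarith
  have hw0 : w ≠ 0 := by
    rintro h
    rw [h, inner_zero_right] at huw
    linarith
  have hN : 0 < ‖w‖ := norm_pos_iff.2 hw0
  have hcos : (1 - c ^ 2) * ‖w‖ ≤ 1 + c * s := by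
    refine (sq_le_sq₀ (mul_nonneg (by nlinarith) hN.le) hpos.le).1 ?_
    have h1 : (1 - c ^ 2) * (1 - c ^ 2) ≤ (1 - c ^ 2) * 1 :=
      mul_le_mul_of_nonneg_left (by nlinarith) (by nlinarith)
    have h2 := mul_le_mul_of_nonneg_right h1 (sq_nonneg ‖w‖)
    have h3 : 0 ≤ (c * (s + c)) ^ 2 := sq_nonneg _
    rw [mul_pow]
    rw [hN2] at h2 ⊢
    nlinarith
  have hcos' : 1 - c ^ 2 ≤ ‖w‖⁻¹ * (1 + c * s) := by
    rwa [inv_mul_eq_div, le_div_iff₀ hN]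
  refine (sq_le_sq₀ (by positivity) (by positivity)).1 ?_
  rw [norm_sub_sq_real, inner_smul_right, huw, norm_smul, norm_inv, norm_norm,
    inv_mul_cancel₀ hN.ne', hu, mul_pow, Real.sq_sqrt (by norm_num)]
  linarith

theorem norm_sub_normalize_perturbed_le {x y v : E} (hx : ‖x‖ = 1) (hy : y ≠ 0)
    (hv : ‖v‖ = 1) {c : ℝ} (hc0 : 0 ≤ c) (hc1 : c < 1) :
    ‖x - ‖‖y‖⁻¹ • y + c • v‖⁻¹ • (‖y‖⁻¹ • y + c • v)‖ ≤ 2 * ‖x - y‖ + √2 * c := by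
  have hu : ‖‖y‖⁻¹ • y‖ = 1 := norm_smul_inv_norm (𝕜 := ℝ) hy
  refine (norm_sub_le_norm_sub_add_norm_sub _ (‖y‖⁻¹ • y) _).trans ?_
  exact add_le_add (norm_sub_normalize_le hx hy) (norm_sub_normalize_add_smul_le hu hv hc0 hc1)

end InnerProductSpace

/-- If `θ ∈ S^{d-1}` lies in the confidence ellipsoid `⟨θ-θ̂, V(θ-θ̂)⟩ ≤ β` of a
symmetric matrix `V` with `λ_min(V) > 1`, then the optimistic probe directions
`a±`, obtained by normalizing `θ̂/‖θ̂‖ ± v/√(λ_min V)` for any unit `v`, satisfy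
`‖θ − a±‖ ≤ 2√(β/λ_min V) + √(2/λ_min V)`. -/
theorem optimistic_probe_close_to_theta
    {d : ℕ} (hd : 2 ≤ d)
    (V : Matrix (Fin d) (Fin d) ℝ) (hV : V.IsHermitian)
    (hmin : 1 < matLamMin V)
    (β : ℝ) (hβ : 0 ≤ β)
    (θ θhat : Fin d → ℝ) (hθ : evnorm θ = 1) (hθhat : θhat ≠ 0)
    (hconf : (θ - θhat) ⬝ᵥ V.mulVec (θ - θhat) ≤ β)
    (v : Fin d → ℝ) (hv : evnorm v = 1) :
    evnorm (θ - unitize (unitize θhat + (Real.sqrt (matLamMin V))⁻¹ • v))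
        ≤ 2 * Real.sqrt (β / matLamMin V) + Real.sqrt (2 / matLamMin V) ∧
    evnorm (θ - unitize (unitize θhat - (Real.sqrt (matLamMin V))⁻¹ • v))
        ≤ 2 * Real.sqrt (β / matLamMin V) + Real.sqrt (2 / matLamMin V) := by
  have hl : 0 < matLamMin V := one_pos.trans hmin
  have hc0 : 0 ≤ (Real.sqrt (matLamMin V))⁻¹ := by positivity
  have hc1 : (Real.sqrt (matLamMin V))⁻¹ < 1 :=
    inv_lt_one_of_one_lt₀ (Real.lt_sqrt_of_sq_lt (by simpa using hmin))
  have hc : Real.sqrt 2 * (Real.sqrt (matLamMin V))⁻¹ = Real.sqrt (2 / matLamMin V) := by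
    rw [Real.sqrt_div (by norm_num), div_eq_mul_inv]
  have hdist : ‖WithLp.toLp 2 θ - WithLp.toLp 2 θhat‖ ≤ Real.sqrt (β / matLamMin V) := by
    rw [← WithLp.toLp_sub, ← evnorm_eq_norm]
    refine Real.le_sqrt_of_sq_le ((le_div_iff₀' hl).2 ?_)
    exact (matLamMin_mul_evnorm_sq_le hV _).trans hconf
  have hθ' : ‖WithLp.toLp 2 θ‖ = 1 := by rw [← evnorm_eq_norm, hθ]
  have hv' : ‖WithLp.toLp 2 v‖ = 1 := by rw [← evnorm_eq_norm, hv]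
  have hθhat' : WithLp.toLp 2 θhat ≠ 0 := by simpa using hθhat
  have key := fun w hw => norm_sub_normalize_perturbed_le hθ' hθhat' (v := w) hw hc0 hc1
  constructor
  · have h := key _ hv'
    rw [evnorm_eq_norm, WithLp.toLp_sub, toLp_unitize, WithLp.toLp_add, toLp_unitize,
      WithLp.toLp_smul]
    linarith
  · have h := key (-WithLp.toLp 2 v) (by rw [norm_neg, hv'])
    rw [smul_neg, ← sub_eq_add_neg] at h
    rw [evnorm_eq_norm, WithLp.toLp_sub, toLp_unitize, WithLp.toLp_sub, toLp_unitize,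
      WithLp.toLp_smul]
    linarith
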